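/- arXiv:1502.00926 — 2 statements merged into one kernel-verified Lean document; each statement's English description precedes it below -/
import Mathlib

section
/- Let A be an n×n real Hurwitz matrix and Q an n×n real symmetric positive semidefinite matrix. If P is the unique solution of PA + AᵀP + Q = 0, then trace(P) ≥ -∑_{i=1}^n λ_min(Q) / (2·Re(λ_i(A))), where λ_1(A),…,λ_n(A) are the eigenvalues of A counted with multiplicity and λ_min(Q) is the smallest eigenvalue of Q. -/
open Matrix

namespace Matrix

/-- One step of Schur triangularization: a complex matrix is unitarily similar to a block upper
triangular matrix whose last diagonal block has size one. -/
lemma exists_unitary_conj_eq_fromBlocks {n : ℕ} (A : Matrix (Fin (n + 1)) (Fin (n + 1)) ℂ) :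
    ∃ (U : Matrix (Fin (n + 1)) (Fin n ⊕ Unit) ℂ) (B : Matrix (Fin n) (Fin n) ℂ)
      (b : Matrix (Fin n) Unit ℂ) (c : ℂ), Uᴴ * U = 1 ∧ U * Uᴴ = 1 ∧
        Uᴴ * A * U = fromBlocks B b 0 (diagonal fun _ => c) := by
  obtain ⟨μ, hμ⟩ := Module.End.exists_eigenvalue (toLpLin 2 2 Aᴴ)
  obtain ⟨v, hv⟩ := hμ.exists_hasEigenvector
  set u : EuclideanSpace ℂ (Fin (n + 1)) := ((‖v‖⁻¹ : ℝ) : ℂ) • v with hu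
  have hu1 : ‖u‖ = 1 := by
    have : ‖v‖ ≠ 0 := norm_ne_zero_iff.mpr hv.2
    rw [hu, norm_smul]
    simp [this]
  have hAu : toLpLin 2 2 Aᴴ u = μ • u := by
    rw [hu, map_smul, hv.apply_eq_smul, smul_comm]
  obtain ⟨e, he⟩ := Orthonormal.exists_orthonormalBasis_extension_of_card_eq (𝕜 := ℂ)
    (E := EuclideanSpace ℂ (Fin (n + 1))) (ι := Fin n ⊕ Unit) (by simp)
    (v := fun _ => u) (s := {Sum.inr ()}) (by
      rw [orthonormal_iff_ite]
      rintro ⟨i, hi⟩ ⟨j, hj⟩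
      obtain rfl : i = _ := hi
      obtain rfl : j = _ := hj
      simp [inner_self_eq_norm_sq_to_K, hu1])
  have he := he (Sum.inr ()) rfl
  set U : Matrix (Fin (n + 1)) (Fin n ⊕ Unit) ℂ := of fun i j => e j i with hU
  have h1 : Uᴴ * U = 1 := by
    ext i j
    have := orthonormal_iff_ite.mp e.orthonormal i j
    rw [one_apply, ← this]
    simp [mul_apply, U, PiLp.inner_apply, mul_comm]
  have h2 : U * Uᴴ = 1 := (mul_eq_one_comm_of_equiv
    ((finSumFinEquiv (m := n) (n := 1)).symm.trans
      (Equiv.sumCongr (Equiv.refl _) (Equiv.ofUnique _ _)))).mpr h1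
  have hcol : ∀ i, (Aᴴ * U) i (Sum.inr ()) = μ * U i (Sum.inr ()) := by
    intro i
    have := congrArg (fun w : EuclideanSpace ℂ (Fin (n + 1)) => w i) hAu
    simpa [mul_apply, U, he, mulVec, dotProduct] using this
  have hrow : ∀ j, (Uᴴ * A * U) (Sum.inr ()) j =
      star μ * (1 : Matrix (Fin n ⊕ Unit) (Fin n ⊕ Unit) ℂ) (Sum.inr ()) j := by
    intro j
    have hUA : ∀ k, (Uᴴ * A) (Sum.inr ()) k = star μ * Uᴴ (Sum.inr ()) k := by
      intro k
      have := congrArg star (hcol k)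
      rw [← conjTranspose_apply, conjTranspose_mul, conjTranspose_conjTranspose] at this
      simpa [conjTranspose_apply] using this
    rw [← h1, mul_apply, mul_apply, Finset.mul_sum]
    simp only [hUA, mul_assoc]
  refine ⟨U, (Uᴴ * A * U).toBlocks₁₁, (Uᴴ * A * U).toBlocks₁₂, star μ, h1, h2, ?_⟩
  conv_lhs => rw [← fromBlocks_toBlocks (Uᴴ * A * U)]
  congr 1
  · ext i j
    simp [toBlocks₂₁, hrow]
  · ext i j
    simp [toBlocks₂₂, hrow]

/-- The Lyapunov operator of a matrix with spectrum in the open left half-plane is injective. -/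
lemma eq_zero_of_mul_add_conjTranspose_mul_eq_zero {n : Type*} [Fintype n] [DecidableEq n]
    {A X : Matrix n n ℂ} (hA : ∀ μ ∈ A.charpoly.roots, μ.re < 0) (hX : X * A + Aᴴ * X = 0) :
    X = 0 := by
  have hsemi : SemiconjBy X A (-Aᴴ) := by
    rw [SemiconjBy, neg_mul]
    exact eq_neg_of_add_eq_zero_left hX
  have hpoly : ∀ p : Polynomial ℂ,
      X * Polynomial.aeval A p = Polynomial.aeval (-Aᴴ) p * X := by
    intro p
    induction p using Polynomial.induction_on' with
    | add p q hp hq => simp [mul_add, add_mul, hp, hq]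
    | monomial k a =>
      have := (hsemi.pow_right k).eq
      simp only [Polynomial.aeval_monomial, Algebra.algebraMap_eq_smul_one, smul_mul_assoc,
        one_mul, mul_smul_comm, this]
  have hunit : IsUnit (Polynomial.aeval (-Aᴴ) A.charpoly) := by
    cases isEmpty_or_nonempty n
    · exact isUnit_of_subsingleton _
    rw [← spectrum.zero_notMem_iff ℂ, spectrum.map_polynomial_aeval_of_nonempty _ _
      (spectrum.nonempty_of_isAlgClosed_of_finiteDimensional ℂ _)]
    rintro ⟨k, hk, hk0⟩
    have hroot : ∀ z, A.charpoly.IsRoot z → z.re < 0 := fun z hz =>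
      hA z ((Polynomial.mem_roots A.charpoly_monic.ne_zero).mpr hz)
    have hk' : -star k ∈ spectrum ℂ A := by
      rw [← spectrum.neg_eq, Set.mem_neg] at hk
      by_contra hcon
      have hres : star (-k) ∈ resolventSet ℂ A := by
        rw [star_neg]
        exact not_not.mp hcon
      exact hk (spectrum.star_mem_resolventSet_iff.mp hres)
    rw [mem_spectrum_iff_isRoot_charpoly] at hk'
    have h1 := hroot _ hk'
    have h2 := hroot _ hk0
    simp at h1
    linarith
  have h := hpoly A.charpoly
  rw [aeval_self_charpoly, mul_zero] at h
  exact hunit.mul_right_eq_zero.mp h.symm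

section

open scoped ComplexOrder

/-- Lower bound for the Schur complement of a solution of a block triangular Lyapunov equation. -/
lemma PosDef.le_schurComplement_of_lyapunov {m : Type*} [Fintype m] [DecidableEq m]
    {X B : Matrix m m ℂ} {x b : Matrix m Unit ℂ} {D : Matrix Unit Unit ℂ} {c : ℂ}
    {Q : Matrix (m ⊕ Unit) (m ⊕ Unit) ℂ} {q : ℝ} (hq : 0 ≤ q) (hX : X.PosDef)
    (hD : D.IsHermitian) (hc : c.re < 0) (hQ : (Q - (q : ℂ) • 1).PosSemidef)
    (h : fromBlocks X x xᴴ D * fromBlocks B b 0 (diagonal fun _ => c) +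
      (fromBlocks B b 0 (diagonal fun _ => c))ᴴ * fromBlocks X x xᴴ D + Q = 0) :
    -(q / (2 * c.re)) ≤ ((D - xᴴ * X⁻¹ * x) () ()).re := by
  set S := D - xᴴ * X⁻¹ * x with hS
  set V : Matrix (m ⊕ Unit) Unit ℂ := fromRows (-(X⁻¹ * x)) 1 with hV
  set T := fromBlocks B b 0 (diagonal fun _ : Unit => c) with hT
  set M := fromBlocks X x xᴴ D with hM
  have hdet : IsUnit X.det := (isUnit_iff_isUnit_det X).mp hX.isUnit
  have hMV : M * V = fromRows 0 S := by
    rw [hM, hV, fromBlocks_mul_fromRows, hS]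
    congr 1
    · rw [Matrix.mul_neg, mul_nonsing_inv_cancel_left _ _ hdet, Matrix.mul_one, neg_add_cancel]
    · rw [Matrix.mul_neg, Matrix.mul_one, ← Matrix.mul_assoc]; abel
  have hMh : Mᴴ = M := by
    rw [hM, fromBlocks_conjTranspose, hX.1.eq, hD.eq, conjTranspose_conjTranspose]
  have hSh : Sᴴ = S := by
    rw [hS]
    simp [conjTranspose_sub, conjTranspose_mul, conjTranspose_nonsing_inv, hX.1.eq, hD.eq,
      Matrix.mul_assoc]
  have h1 : Vᴴ * (M * T) * V = S * diagonal fun _ => c := by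
    have : Vᴴ * (M * T) * V = (M * V)ᴴ * (T * V) := by
      rw [conjTranspose_mul, hMh]; simp only [Matrix.mul_assoc]
    rw [this, hMV, hT, hV, fromBlocks_mul_fromRows,
      conjTranspose_fromRows_eq_fromCols_conjTranspose, fromCols_mul_fromRows, hSh]
    simp
  have h2 : Vᴴ * (Tᴴ * M) * V = (S * diagonal fun _ => c)ᴴ := by
    rw [← h1]
    simp only [conjTranspose_mul, conjTranspose_conjTranspose, hMh, Matrix.mul_assoc]
  have h3 : S * diagonal (fun _ => c) + (S * diagonal fun _ => c)ᴴ + Vᴴ * Q * V = 0 := by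
    rw [← h2, ← h1, ← Matrix.add_mul, ← Matrix.add_mul, ← Matrix.mul_add, ← Matrix.mul_add, h,
      Matrix.mul_zero, Matrix.zero_mul]
  have h4 : Vᴴ * V = (X⁻¹ * x)ᴴ * (X⁻¹ * x) + 1 := by
    rw [hV, conjTranspose_fromRows_eq_fromCols_conjTranspose, fromCols_mul_fromRows]
    simp
  have h5 : 0 ≤ ((Vᴴ * (Q - (q : ℂ) • (1 : Matrix (m ⊕ Unit) (m ⊕ Unit) ℂ)) * V) () ()).re :=
    (Complex.le_def.mp (hQ.conjTranspose_mul_mul_same V).diag_nonneg).1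
  have h6 : 0 ≤ (((X⁻¹ * x)ᴴ * (X⁻¹ * x)) () ()).re :=
    (Complex.le_def.mp (posSemidef_conjTranspose_mul_self (X⁻¹ * x)).diag_nonneg).1
  have h7 : Vᴴ * (Q - (q : ℂ) • (1 : Matrix (m ⊕ Unit) (m ⊕ Unit) ℂ)) * V =
      Vᴴ * Q * V - (q : ℂ) • (Vᴴ * V) := by
    simp [Matrix.mul_sub, Matrix.sub_mul]
  rw [h7, h4] at h5
  have him : (S () ()).im = 0 := by
    have := congrFun₂ hSh () ()
    rw [conjTranspose_apply] at this
    exact Complex.conj_eq_iff_im.mp this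
  have h8 := congrArg Complex.re (congrFun₂ h3 () ())
  simp [him, -conjTranspose_mul] at h8 h5
  have h9 : q ≤ -(2 * c.re) * (S () ()).re := by nlinarith [mul_nonneg hq h6]
  have h10 : -(q / (2 * c.re)) = q / (-(2 * c.re)) := by rw [div_neg]
  rw [h10, div_le_iff₀ (by linarith)]
  linarith

lemma PosDef.fromBlocks_of_schurComplement {m : Type*} [Fintype m] [DecidableEq m]
    {X : Matrix m m ℂ} {x : Matrix m Unit ℂ} {D : Matrix Unit Unit ℂ} (hX : X.PosDef)
    (hD : D.IsHermitian) (hS : 0 < ((D - xᴴ * X⁻¹ * x) () ()).re) :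
    (fromBlocks X x xᴴ D).PosDef := by
  let := hX.isUnit.invertible
  have hSh : (D - xᴴ * X⁻¹ * x).IsHermitian := by
    simp [IsHermitian, conjTranspose_sub, conjTranspose_mul, conjTranspose_nonsing_inv, hX.1.eq,
      hD.eq, Matrix.mul_assoc]
  have hpos : 0 < (D - xᴴ * X⁻¹ * x) () () := by
    rw [Complex.lt_def]
    refine ⟨hS, (Complex.conj_eq_iff_im.mp ?_).symm⟩
    exact congrFun₂ hSh.eq () ()
  have hSD : D - xᴴ * X⁻¹ * x = diagonal fun _ => (D - xᴴ * X⁻¹ * x) () () := by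
    ext i j; simp
  have hpsd : (fromBlocks X x xᴴ D).PosSemidef := by
    rw [hX.fromBlocks₁₁, hSD]
    exact PosSemidef.diagonal fun _ => hpos.le
  rw [hpsd.posDef_iff_isUnit, isUnit_iff_isUnit_det, det_fromBlocks₁₁, invOf_eq_nonsing_inv,
    isUnit_iff_ne_zero]
  refine mul_ne_zero hX.det_pos.ne' ?_
  rw [hSD, det_diagonal]
  simpa using hpos.ne'

/-- The trace bound for the Lyapunov equation in the strictly positive definite case. -/
lemma posDef_and_le_trace_of_lyapunov {q : ℝ} (hq : 0 < q) {n : ℕ}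
    (A Q P : Matrix (Fin n) (Fin n) ℂ)
    (hA : ∀ μ ∈ A.charpoly.roots, μ.re < 0) (hP : P.IsHermitian)
    (hQ : (Q - (q : ℂ) • 1).PosSemidef) (h : P * A + Aᴴ * P + Q = 0) :
    P.PosDef ∧ (A.charpoly.roots.map fun μ => -(q / (2 * μ.re))).sum ≤ P.trace.re := by
  induction n with
  | zero =>
    refine ⟨?_, by simp⟩
    rw [Subsingleton.elim P 1]
    exact PosDef.one
  | succ n ih =>
    obtain ⟨U, B, b, c, h1, h2, hT⟩ := exists_unitary_conj_eq_fromBlocks A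
    have hchar : A.charpoly = B.charpoly * (Polynomial.X - Polynomial.C c) := by
      have hsim : (Uᴴ * A * U).charpoly = A.charpoly := by
        rw [charpoly_mul_comm_of_le _ _ (by simp), ← Matrix.mul_assoc, h2]
        simp
      rw [← hsim, hT, charpoly_fromBlocks_zero₂₁, charpoly_diagonal]
      simp
    have hne : B.charpoly * (Polynomial.X - Polynomial.C c) ≠ 0 :=
      mul_ne_zero B.charpoly_monic.ne_zero (Polynomial.X_sub_C_ne_zero c)
    have hroots : A.charpoly.roots = B.charpoly.roots + {c} := by
      rw [hchar, Polynomial.roots_mul hne, Polynomial.roots_X_sub_C]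
    rw [hroots] at hA ⊢
    obtain ⟨X, x, x', D, hM⟩ : ∃ X x x' D, Uᴴ * P * U = fromBlocks X x x' D :=
      ⟨_, _, _, _, (fromBlocks_toBlocks _).symm⟩
    have hMh : (fromBlocks X x x' D).IsHermitian := hM ▸ isHermitian_conjTranspose_mul_mul U hP
    obtain ⟨hXh, rfl, -, hDh⟩ := isHermitian_fromBlocks_iff.mp hMh
    have hQU : (Uᴴ * Q * U - (q : ℂ) • 1).PosSemidef := by
      have := hQ.conjTranspose_mul_mul_same U
      rwa [Matrix.mul_sub, Matrix.sub_mul, Matrix.mul_smul, Matrix.smul_mul, Matrix.mul_one,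
        h1] at this
    have hL : fromBlocks X x xᴴ D * fromBlocks B b 0 (diagonal fun _ => c) +
        (fromBlocks B b 0 (diagonal fun _ => c))ᴴ * fromBlocks X x xᴴ D + Uᴴ * Q * U = 0 := by
      rw [← hM, ← hT]
      calc _ = Uᴴ * (P * (U * Uᴴ) * A + Aᴴ * (U * Uᴴ) * P + Q) * U := by
            simp only [conjTranspose_mul, conjTranspose_conjTranspose, Matrix.mul_add,
              Matrix.add_mul, Matrix.mul_assoc]
        _ = 0 := by rw [h2, Matrix.mul_one, Matrix.mul_one, h, Matrix.mul_zero, Matrix.zero_mul]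
    have hsub : (Uᴴ * Q * U - (q : ℂ) • 1).toBlocks₁₁ = (Uᴴ * Q * U).toBlocks₁₁ - (q : ℂ) • 1 := by
      ext i j
      simp [toBlocks₁₁, one_apply]
    have hL₁ : X * B + Bᴴ * X + (Uᴴ * Q * U).toBlocks₁₁ = 0 := by
      have := congrArg toBlocks₁₁ hL
      rw [fromBlocks_conjTranspose, fromBlocks_multiply, fromBlocks_multiply,
        fromBlocks_add] at this
      ext i j
      have := congrFun₂ this i j
      simpa [toBlocks₁₁] using this
    obtain ⟨hX, htr⟩ := ih B _ X (fun μ hμ => hA μ (Multiset.mem_add.mpr (Or.inl hμ))) hXh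
      (hsub ▸ hQU.submatrix Sum.inl) hL₁
    have hc : c.re < 0 := hA c (by simp)
    have hS := hX.le_schurComplement_of_lyapunov hq.le hDh hc hQU hL
    have hSpos : 0 < ((D - xᴴ * X⁻¹ * x) () ()).re := by
      refine lt_of_lt_of_le ?_ hS
      have := div_neg_of_pos_of_neg hq (by linarith : 2 * c.re < 0)
      linarith
    have hMpos := hX.fromBlocks_of_schurComplement hDh hSpos
    have hPeq : P = U * fromBlocks X x xᴴ D * Uᴴ := by
      rw [← hM]
      calc P = (U * Uᴴ) * P * (U * Uᴴ) := by rw [h2, Matrix.one_mul, Matrix.mul_one]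
        _ = _ := by simp only [Matrix.mul_assoc]
    constructor
    · rw [hPeq]
      refine hMpos.mul_mul_conjTranspose_same ?_
      intro v w hvw
      have := congrArg (fun z => z ᵥ* Uᴴ) hvw
      simpa [vecMul_vecMul, h2] using this
    · have htrP : P.trace = X.trace + D () () := by
        rw [hPeq, trace_mul_comm, ← Matrix.mul_assoc, h1, Matrix.one_mul]
        simp [trace]
      have hpos : 0 ≤ ((xᴴ * X⁻¹ * x) () ()).re :=
        (Complex.le_def.mp (hX.inv.posSemidef.conjTranspose_mul_mul_same x).diag_nonneg).1
      rw [sub_apply, Complex.sub_re] at hS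
      rw [htrP, Complex.add_re, Multiset.map_add, Multiset.sum_add, Multiset.map_singleton,
        Multiset.sum_singleton]
      linarith

/-- A Hurwitz matrix admits a Hermitian solution of the Lyapunov equation with `Q = 1`. -/
lemma exists_isHermitian_lyapunov {n : Type*} [Fintype n] [DecidableEq n]
    {A : Matrix n n ℂ} (hA : ∀ μ ∈ A.charpoly.roots, μ.re < 0) :
    ∃ X : Matrix n n ℂ, X.IsHermitian ∧ X * A + Aᴴ * X + 1 = 0 := by
  let L : Matrix n n ℂ →ₗ[ℂ] Matrix n n ℂ := LinearMap.mulRight ℂ A + LinearMap.mulLeft ℂ Aᴴ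
  have hinj : Function.Injective L := (injective_iff_map_eq_zero L).mpr fun X hX =>
    eq_zero_of_mul_add_conjTranspose_mul_eq_zero hA (by simpa [L] using hX)
  obtain ⟨X, hX⟩ := LinearMap.injective_iff_surjective.mp hinj (-1)
  have hX : X * A + Aᴴ * X = -1 := by simpa [L] using hX
  refine ⟨X, ?_, by rw [hX, neg_add_cancel]⟩
  refine hinj ?_
  have := congrArg conjTranspose hX
  simp only [conjTranspose_add, conjTranspose_mul, conjTranspose_conjTranspose,
    conjTranspose_neg, conjTranspose_one] at this
  simp only [L, LinearMap.add_apply, LinearMap.mulRight_apply, LinearMap.mulLeft_apply]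
  rw [hX, add_comm, this]

/-- The trace bound for the Lyapunov equation over `ℂ`. -/
lemma le_trace_of_lyapunov {q : ℝ} (hq : 0 ≤ q) {n : ℕ} {A Q P : Matrix (Fin n) (Fin n) ℂ}
    (hA : ∀ μ ∈ A.charpoly.roots, μ.re < 0) (hP : P.IsHermitian)
    (hQ : (Q - (q : ℂ) • 1).PosSemidef) (h : P * A + Aᴴ * P + Q = 0) :
    (A.charpoly.roots.map fun μ => -(q / (2 * μ.re))).sum ≤ P.trace.re := by
  obtain ⟨X, hXh, hX⟩ := exists_isHermitian_lyapunov hA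
  have hsum : ∀ r : ℝ, (A.charpoly.roots.map fun μ => -(r / (2 * μ.re))).sum =
      r * (A.charpoly.roots.map fun μ => -(1 / (2 * μ.re))).sum := by
    intro r
    rw [← Multiset.sum_map_mul_left]
    congr 2
    ext μ
    ring
  have key : ∀ ε : ℝ, 0 < ε → (A.charpoly.roots.map fun μ => -((q + ε) / (2 * μ.re))).sum ≤
      P.trace.re + ε * X.trace.re := by
    intro ε hε
    have := (posDef_and_le_trace_of_lyapunov (by linarith : 0 < q + ε) A (Q + (ε : ℂ) • 1)
      (P + (ε : ℂ) • X) hA ?_ ?_ ?_).2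
    · simpa [trace_add, trace_smul] using this
    · simp [IsHermitian, conjTranspose_add, conjTranspose_smul, hP.eq, hXh.eq]
    · convert hQ using 1
      push_cast
      module
    · calc _ = (P * A + Aᴴ * P + Q) + (ε : ℂ) • (X * A + Aᴴ * X + 1) := by
            simp only [add_mul, mul_add, smul_mul_assoc, mul_smul_comm]; module
        _ = 0 := by rw [h, hX]; simp
  rw [hsum]
  set s := (A.charpoly.roots.map fun μ => -(1 / (2 * μ.re))).sum
  have hlim : ∀ a b : ℝ, Filter.Tendsto (fun ε : ℝ => a + ε * b) (nhdsWithin 0 (Set.Ioi 0))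
      (nhds a) := fun a b =>
    tendsto_nhdsWithin_of_tendsto_nhds <| by
      have : Continuous fun ε : ℝ => a + ε * b := by fun_prop
      simpa using this.tendsto 0
  refine le_of_tendsto_of_tendsto (hlim (q * s) s) (hlim _ X.trace.re) ?_
  filter_upwards [self_mem_nhdsWithin] with ε hε
  have := key ε hε
  rwa [hsum, add_mul] at this

open scoped MatrixOrder in
lemma PosSemidef.map_complex_ofReal {n : Type*} [Fintype n] {M : Matrix n n ℝ}
    (hM : M.PosSemidef) : (M.map Complex.ofReal).PosSemidef := by
  classical
  obtain ⟨B, rfl⟩ := CStarAlgebra.nonneg_iff_eq_star_mul_self.mp hM.nonneg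
  rw [star_eq_conjTranspose]
  have : (Bᴴ * B).map Complex.ofReal = (B.map Complex.ofReal)ᴴ * B.map Complex.ofReal := by
    ext i j
    simp [mul_apply]
  rw [this]
  exact posSemidef_conjTranspose_mul_self _

lemma IsHermitian.posSemidef_sub_iInf_eigenvalues {n : Type*} [Fintype n] [DecidableEq n]
    {M : Matrix n n ℝ} (hM : M.IsHermitian) :
    (M - (⨅ i, hM.eigenvalues i) • (1 : Matrix n n ℝ)).PosSemidef := by
  set q := ⨅ i, hM.eigenvalues i
  set U := hM.eigenvectorUnitary
  have hU : (U : Matrix n n ℝ) * star (U : Matrix n n ℝ) = 1 := Unitary.coe_mul_star_self U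
  have : M - q • (1 : Matrix n n ℝ) =
      (U : Matrix n n ℝ) * diagonal (fun i => hM.eigenvalues i - q) * (U : Matrix n n ℝ)ᴴ := by
    have hs := hM.spectral_theorem
    rw [Unitary.conjStarAlgAut_apply] at hs
    have hd : diagonal (fun i => hM.eigenvalues i - q) =
        diagonal (RCLike.ofReal ∘ hM.eigenvalues) - q • (1 : Matrix n n ℝ) := by
      ext i j
      by_cases hij : i = j <;> simp [hij]
    rw [hd, mul_sub, sub_mul, ← star_eq_conjTranspose, mul_smul_comm, mul_one, smul_mul_assoc, hU]
    conv_lhs => rw [hs]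
  rw [this]
  refine PosSemidef.mul_mul_conjTranspose_same (PosSemidef.diagonal fun i => ?_) _
  exact sub_nonneg.mpr (ciInf_le (Set.finite_range _).bddBelow i)

/-- The trace bound for the Lyapunov equation over `ℝ`. -/
lemma le_trace_of_lyapunov_real {q : ℝ} (hq : 0 ≤ q) {n : ℕ} {A Q P : Matrix (Fin n) (Fin n) ℝ}
    (hA : ∀ μ ∈ (A.map Complex.ofReal).charpoly.roots, μ.re < 0) (hQs : Q.IsHermitian)
    (hQ : (Q - q • (1 : Matrix (Fin n) (Fin n) ℝ)).PosSemidef) (h : P * A + Aᵀ * P + Q = 0) :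
    ((A.map Complex.ofReal).charpoly.roots.map fun μ => -(q / (2 * μ.re))).sum ≤ P.trace := by
  have hAc : (A.map Complex.ofReal)ᴴ = Aᵀ.map Complex.ofReal := by
    ext i j
    simp
  have hmul : ∀ M N : Matrix (Fin n) (Fin n) ℝ,
      (M * N).map Complex.ofReal = M.map Complex.ofReal * N.map Complex.ofReal :=
    fun M N => Matrix.map_mul (f := Complex.ofRealHom)
  have hPc : P.map Complex.ofReal * A.map Complex.ofReal +
      (A.map Complex.ofReal)ᴴ * P.map Complex.ofReal + Q.map Complex.ofReal = 0 := by
    rw [hAc, ← hmul, ← hmul]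
    ext i j
    have := congrArg Complex.ofReal (congrFun₂ h i j)
    simpa using this
  have hQc : ((Q.map Complex.ofReal) -
      (q : ℂ) • (1 : Matrix (Fin n) (Fin n) ℂ)).PosSemidef := by
    convert hQ.map_complex_ofReal using 1
    ext i j
    by_cases hij : i = j <;> simp [hij]
  have hQh : (Q.map Complex.ofReal)ᴴ = Q.map Complex.ofReal := by
    have := hQs.map (f := Complex.ofReal) (fun x => by simp)
    exact this
  have hPh : (P.map Complex.ofReal).IsHermitian := by
    refine sub_eq_zero.mp (eq_zero_of_mul_add_conjTranspose_mul_eq_zero hA ?_)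
    have := congrArg conjTranspose hPc
    simp only [conjTranspose_add, conjTranspose_mul, conjTranspose_conjTranspose, hQh,
      conjTranspose_zero] at this
    rw [sub_mul, mul_sub]
    calc _ = ((A.map Complex.ofReal)ᴴ * (P.map Complex.ofReal)ᴴ +
            (P.map Complex.ofReal)ᴴ * A.map Complex.ofReal + Q.map Complex.ofReal) -
          (P.map Complex.ofReal * A.map Complex.ofReal +
            (A.map Complex.ofReal)ᴴ * P.map Complex.ofReal + Q.map Complex.ofReal) := by abel
      _ = 0 := by rw [this, hPc, sub_zero]
  have htr : (P.map Complex.ofReal).trace.re = P.trace := by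
    simp [trace]
  exact htr ▸ le_trace_of_lyapunov hq hA hPh hQc hPc

end

end Matrix

/-- Lower bound on `trace P` for the Lyapunov equation:
`trace(P) ≥ -∑ᵢ λ_min(Q) / (2 Re λᵢ(A))`, where the sum ranges over the eigenvalues of `A`
(roots of the characteristic polynomial over `ℂ`, with multiplicity). -/
theorem trace_lyapunov_lower_bound {n : ℕ} (hn : 0 < n) (A Q P : Matrix (Fin n) (Fin n) ℝ)
    (hHurwitz : ∀ μ ∈ (A.map (Complex.ofReal)).charpoly.roots, μ.re < 0)
    (hQ : Q.PosSemidef)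
    (hP : P * A + Aᵀ * P + Q = 0) :
    P.trace ≥
      -((A.map (Complex.ofReal)).charpoly.roots.map
          (fun μ => (⨅ i, hQ.1.eigenvalues i) / (2 * μ.re))).sum := by
  have h := le_trace_of_lyapunov_real (Real.iInf_nonneg hQ.eigenvalues_nonneg) hHurwitz hQ.1
    hQ.1.posSemidef_sub_iInf_eigenvalues hP
  rwa [Multiset.sum_map_neg] at h
end

section
/- Let A be an n×n real Hurwitz matrix whose symmetric part A_s = (A + Aᵀ)/2 is also Hurwitz (negative definite), and let Q be an n×n real symmetric positive semidefinite matrix. If P is the unique solution of the Lyapunov equation PA + AᵀP + Q = 0, then trace(P) ≤ -∑_{i=1}^n λ_i(Q) / (2·λ_i(A_s)), where the eigenvalues of Q and of A_s are both indexed in ascending order. -/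
open Matrix

/-- Two enumerations of the same multiset differ by a permutation. -/
theorem exists_eq_comp_perm_of_map_univ_eq {α : Type*} [LinearOrder α] {n : ℕ} {f g : Fin n → α}
    (h : Finset.univ.val.map f = Finset.univ.val.map g) :
    ∃ σ : Equiv.Perm (Fin n), f = g ∘ σ := by
  have hperm : (List.ofFn f).Perm (List.ofFn g) := by simpa using h
  have hsort : f ∘ Tuple.sort f = g ∘ Tuple.sort g :=
    List.ofFn_injective <| List.Perm.eq_of_sortedLE (Tuple.monotone_sort f).sortedLE_ofFn
      (Tuple.monotone_sort g).sortedLE_ofFn <|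
        ((Equiv.Perm.ofFn_comp_perm _ f).trans hperm).trans (Equiv.Perm.ofFn_comp_perm _ g).symm
  refine ⟨(Tuple.sort f).symm.trans (Tuple.sort g), funext fun i => ?_⟩
  simpa using congrFun hsort ((Tuple.sort f).symm i)

/-- A real symmetric matrix is orthogonally diagonalised by any enumeration of the roots of its
characteristic polynomial. -/
theorem Matrix.IsHermitian.exists_eq_mul_diagonal_mul_transpose {n : ℕ}
    {M : Matrix (Fin n) (Fin n) ℝ} (hM : M.IsHermitian) {μ : Fin n → ℝ}
    (hμ : M.charpoly.roots = Finset.univ.val.map μ) :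
    ∃ U : Matrix (Fin n) (Fin n) ℝ, U * Uᵀ = 1 ∧ M = U * diagonal μ * Uᵀ := by
  obtain ⟨σ, hσ⟩ : ∃ σ : Equiv.Perm (Fin n), μ = hM.eigenvalues ∘ σ := by
    refine exists_eq_comp_perm_of_map_univ_eq ?_
    have h := hM.roots_charpoly_eq_eigenvalues
    rw [hμ] at h
    exact h
  let V : Matrix (Fin n) (Fin n) ℝ := hM.eigenvectorUnitary
  have hV : V * Vᵀ = 1 := by
    have := Unitary.coe_mul_star_self hM.eigenvectorUnitary
    simpa [star_eq_conjTranspose] using this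
  have hMV : M = V * diagonal hM.eigenvalues * Vᵀ := by
    have := hM.spectral_theorem
    rw [Unitary.conjStarAlgAut_apply] at this
    simpa [star_eq_conjTranspose, Function.comp_def] using this
  refine ⟨V.submatrix id σ, ?_, ?_⟩
  · rw [transpose_submatrix, submatrix_mul_equiv, hV, submatrix_id_id]
  · rw [hσ, ← submatrix_diagonal_equiv, transpose_submatrix, submatrix_mul_equiv,
      submatrix_mul_equiv, submatrix_id_id, ← hMV]

/-- The entrywise square of an orthogonal matrix is doubly stochastic. -/
theorem Matrix.sq_mem_doublyStochastic {n : ℕ} {U : Matrix (Fin n) (Fin n) ℝ}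
    (hU : U * Uᵀ = 1) : (of fun i j => U i j ^ 2) ∈ doublyStochastic ℝ (Fin n) := by
  have hU' : Uᵀ * U = 1 := mul_eq_one_comm.1 hU
  refine mem_doublyStochastic_iff_sum.2 ⟨fun i j => sq_nonneg _, fun i => ?_, fun j => ?_⟩
  · simpa [mul_apply, sq] using congrFun (congrFun hU i) i
  · simpa [mul_apply, sq] using congrFun (congrFun hU' j) j

/-- The diagonal entries of `U * diagonal d * Uᵀ` as weighted sums of the entries of `d`. -/
theorem Matrix.mul_diagonal_mul_transpose_apply_self {n : ℕ} (U : Matrix (Fin n) (Fin n) ℝ)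
    (d : Fin n → ℝ) (i : Fin n) : (U * diagonal d * Uᵀ) i i = ∑ j, U i j ^ 2 * d j := by
  rw [mul_apply]
  exact Finset.sum_congr rfl fun j _ => by rw [mul_diagonal, transpose_apply]; ring

/-- A doubly stochastic bilinear form is maximised on similarly ordered vectors by the identity. -/
theorem Monovary.sum_mul_doublyStochastic_le {n : ℕ} {f g : Fin n → ℝ} (hfg : Monovary f g)
    {M : Matrix (Fin n) (Fin n) ℝ} (hM : M ∈ doublyStochastic ℝ (Fin n)) :
    ∑ i, ∑ j, M i j * (f i * g j) ≤ ∑ i, f i * g i := by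
  obtain ⟨w, hw0, hw1, rfl⟩ := exists_eq_sum_perm_of_mem_doublyStochastic hM
  calc ∑ i, ∑ j, (∑ σ, w σ • σ.permMatrix ℝ) i j * (f i * g j)
      = ∑ σ, w σ * ∑ i, f i * g (σ i) := by
        simp_rw [Matrix.sum_apply, Finset.sum_mul, Finset.mul_sum]
        simp_rw [Finset.sum_comm (s := (Finset.univ : Finset (Fin n)))
          (t := (Finset.univ : Finset (Equiv.Perm (Fin n))))]
        simp [Equiv.Perm.permMatrix, PEquiv.toMatrix_apply]
    _ ≤ ∑ σ, w σ * ∑ i, f i * g i := Finset.sum_le_sum fun σ _ =>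
        mul_le_mul_of_nonneg_left hfg.sum_mul_comp_perm_le_sum_mul (hw0 σ)
    _ = ∑ i, f i * g i := by rw [← Finset.sum_mul, hw1, one_mul]

/-- A weighted mean of positive numbers is positive. -/
theorem sum_mul_pos_of_sum_eq_one {n : ℕ} {w s : Fin n → ℝ} (hw : ∀ i, 0 ≤ w i)
    (hw1 : ∑ i, w i = 1) (hs : ∀ i, 0 < s i) : 0 < ∑ i, w i * s i := by
  obtain ⟨i, hi, hwi⟩ := Finset.exists_lt_of_sum_lt (s := Finset.univ) (f := fun _ => (0 : ℝ))
    (g := w) (by simp [hw1])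
  exact Finset.sum_pos' (fun j _ => mul_nonneg (hw j) (hs j).le) ⟨i, hi, mul_pos hwi (hs i)⟩

/-- The inverse of a weighted mean is at most the weighted mean of the inverses. -/
theorem inv_sum_mul_le_sum_mul_inv {n : ℕ} {w s : Fin n → ℝ} (hw : ∀ i, 0 ≤ w i)
    (hw1 : ∑ i, w i = 1) (hs : ∀ i, 0 < s i) : (∑ i, w i * s i)⁻¹ ≤ ∑ i, w i * (s i)⁻¹ := by
  have hle := Finset.sum_sq_le_sum_mul_sum_of_sq_le_mul Finset.univ (r := w)
    (f := fun i => w i * s i) (g := fun i => w i * (s i)⁻¹)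
    (fun i _ => mul_nonneg (hw i) (hs i).le) (fun i _ => mul_nonneg (hw i) (inv_pos.2 (hs i)).le)
    (fun i _ => le_of_eq (by have := (hs i).ne'; field_simp))
  rw [hw1, one_pow] at hle
  rwa [inv_le_iff_one_le_mul₀' (sum_mul_pos_of_sum_eq_one hw hw1 hs)]

/-- Upper bound on `trace P` for the Lyapunov equation:
`trace(P) ≤ -∑ᵢ λᵢ(Q) / (2 λᵢ(A_s))` where `A_s = (A + Aᵀ)/2` is negative definite and the
eigenvalues of `Q` and `A_s` are both enumerated in ascending order (with multiplicity,
as roots of the respective characteristic polynomials, which all lie in `ℝ`). -/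
theorem trace_lyapunov_upper_bound {n : ℕ} (A Q P : Matrix (Fin n) (Fin n) ℝ)
    (hHurwitz : ∀ μ ∈ (A.map (Complex.ofReal)).charpoly.roots, μ.re < 0)
    (hAs : (-((2 : ℝ)⁻¹ • (A + Aᵀ))).PosDef)
    (hQ : Q.PosSemidef)
    (hP : P * A + Aᵀ * P + Q = 0)
    (μQ μS : Fin n → ℝ) (hμQmono : Monotone μQ) (hμSmono : Monotone μS)
    (hμQ : Q.charpoly.roots = Finset.univ.val.map μQ)
    (hμS : ((2 : ℝ)⁻¹ • (A + Aᵀ)).charpoly.roots = Finset.univ.val.map μS) :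
    P.trace ≤ -∑ i : Fin n, μQ i / (2 * μS i) := by
  have hQT : Qᵀ = Q := by simpa using hQ.isHermitian.eq
  have hSH : ((2 : ℝ)⁻¹ • (A + Aᵀ)).IsHermitian := by
    simp [IsHermitian, add_comm]
  obtain ⟨U, hU, hQU⟩ := hQ.isHermitian.exists_eq_mul_diagonal_mul_transpose hμQ
  obtain ⟨Y, hY, hSY⟩ := hSH.exists_eq_mul_diagonal_mul_transpose hμS
  have hPH : (P + Pᵀ).IsHermitian := by simp [IsHermitian, add_comm]
  obtain ⟨V, hV, hPV⟩ := hPH.exists_eq_mul_diagonal_mul_transpose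
    (μ := hPH.eigenvalues) (by simpa using hPH.roots_charpoly_eq_eigenvalues)
  set p := hPH.eigenvalues
  have hV' : Vᵀ * V = 1 := mul_eq_one_comm.1 hV
  have hY' : Yᵀ * Y = 1 := mul_eq_one_comm.1 hY
  have hμSneg : ∀ i, 0 < -μS i := by
    have hYinj : Function.Injective Y.mulVec := mulVec_injective_of_isUnit
      (IsUnit.of_mul_eq_one _ hY)
    have h := hAs.conjTranspose_mul_mul_same hYinj
    have heq : Yᴴ * -((2 : ℝ)⁻¹ • (A + Aᵀ)) * Y = diagonal (-μS) := by
      rw [hSY, conjTranspose_eq_transpose_of_trivial]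
      change _ = diagonal fun i => -μS i
      rw [← diagonal_neg]
      simp only [Matrix.mul_neg, Matrix.neg_mul, ← Matrix.mul_assoc, hY', Matrix.one_mul]
      rw [Matrix.mul_assoc, hY', Matrix.mul_one]
    rw [heq] at h
    exact posDef_diagonal_iff.1 h
  have hW := Matrix.sq_mem_doublyStochastic (U := Vᵀ * U) (by
    rw [transpose_mul, transpose_transpose, Matrix.mul_assoc, ← Matrix.mul_assoc U, hU,
      Matrix.one_mul, hV'])
  have hZ := Matrix.sq_mem_doublyStochastic (U := Vᵀ * Y) (by
    rw [transpose_mul, transpose_transpose, Matrix.mul_assoc, ← Matrix.mul_assoc Y, hY,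
      Matrix.one_mul, hV'])
  set W : Matrix (Fin n) (Fin n) ℝ := of fun i j => (Vᵀ * U) i j ^ 2 with hWdef
  set Z : Matrix (Fin n) (Fin n) ℝ := of fun i j => (Vᵀ * Y) i j ^ 2 with hZdef
  have hQdiag : ∀ i, (Vᵀ * Q * V) i i = ∑ j, W i j * μQ j := fun i => by
    have := mul_diagonal_mul_transpose_apply_self (Vᵀ * U) μQ i
    simpa [hWdef, hQU, Matrix.mul_assoc] using this
  have hSdiag : ∀ i, (Vᵀ * A * V) i i = ∑ j, Z i j * μS j := fun i => by
    have h := mul_diagonal_mul_transpose_apply_self (Vᵀ * Y) μS i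
    have h1 : (Vᵀ * Y) * diagonal μS * (Vᵀ * Y)ᵀ = Vᵀ * ((2 : ℝ)⁻¹ • (A + Aᵀ)) * V := by
      simp [hSY, Matrix.mul_assoc]
    have h2 : (Vᵀ * Aᵀ * V) i i = (Vᵀ * A * V) i i := by
      rw [← transpose_apply (Vᵀ * A * V)]
      simp only [transpose_mul, transpose_transpose, Matrix.mul_assoc]
    rw [h1] at h
    simp only [Matrix.mul_smul, Matrix.smul_mul, Matrix.mul_add, Matrix.add_mul,
      Matrix.smul_apply, Matrix.add_apply, h2, smul_eq_mul] at h
    simp only [hZdef, of_apply]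
    linarith
  have hlyap : ∀ i, p i * (Vᵀ * A * V) i i + (Vᵀ * Q * V) i i = 0 := fun i => by
    have hsym : (P + Pᵀ) * A + Aᵀ * (P + Pᵀ) + (2 : ℝ) • Q = 0 := by
      have hPT := congrArg transpose hP
      simp only [transpose_add, transpose_mul, transpose_transpose, hQT, transpose_zero] at hPT
      calc _ = (P * A + Aᵀ * P + Q) + (Aᵀ * Pᵀ + Pᵀ * A + Q) := by
            rw [Matrix.add_mul, Matrix.mul_add, two_smul]; abel
        _ = 0 := by rw [hP, hPT, add_zero]
    have h1 : diagonal p * (Vᵀ * A * V) + (Vᵀ * A * V)ᵀ * diagonal p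
        + (2 : ℝ) • (Vᵀ * Q * V) = 0 := by
      calc _ = Vᵀ * ((P + Pᵀ) * A + Aᵀ * (P + Pᵀ) + (2 : ℝ) • Q) * V := by
            rw [hPV]
            simp only [Matrix.mul_add, Matrix.add_mul, Matrix.mul_smul, Matrix.smul_mul,
              transpose_mul, transpose_transpose, ← Matrix.mul_assoc, hV', Matrix.one_mul]
            simp only [Matrix.mul_assoc, hV', Matrix.mul_one]
        _ = 0 := by rw [hsym, Matrix.mul_zero, Matrix.zero_mul]
    have h2 := congrFun (congrFun h1 i) i
    simp only [Matrix.add_apply, diagonal_mul, mul_diagonal, transpose_apply,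
      Matrix.smul_apply, smul_eq_mul, Matrix.zero_apply] at h2
    linarith
  have htrace : 2 * P.trace = ∑ i, p i := by
    have h := congrArg trace hPV
    rw [trace_mul_comm, ← Matrix.mul_assoc, hV', Matrix.one_mul, trace_diagonal, trace_add,
      trace_transpose] at h
    linarith
  have hμQ0 : ∀ i, 0 ≤ ∑ j, W i j * μQ j := fun i => by
    rw [← hQdiag]
    have := (hQ.conjTranspose_mul_mul_same V).diag_nonneg (i := i)
    simpa using this
  have hp : ∀ i, p i ≤ (∑ j, W i j * μQ j) * ∑ k, Z i k * (-μS k)⁻¹ := fun i => by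
    have hJ := inv_sum_mul_le_sum_mul_inv (fun k => nonneg_of_mem_doublyStochastic hZ)
      (sum_row_of_mem_doublyStochastic hZ i) hμSneg
    have hne : ∑ k, Z i k * -μS k ≠ 0 :=
      (sum_mul_pos_of_sum_eq_one (fun k => nonneg_of_mem_doublyStochastic hZ)
        (sum_row_of_mem_doublyStochastic hZ i) hμSneg).ne'
    have h := hlyap i
    rw [hQdiag, hSdiag] at h
    have hpi : p i = (∑ j, W i j * μQ j) * (∑ k, Z i k * -μS k)⁻¹ := by
      rw [eq_mul_inv_iff_mul_eq₀ hne]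
      simp only [mul_neg, Finset.sum_neg_distrib]
      linarith
    rw [hpi]
    exact mul_le_mul_of_nonneg_left hJ (hμQ0 i)
  have hWZ : Wᵀ * Z ∈ doublyStochastic ℝ (Fin n) :=
    mul_mem (transpose_mem_doublyStochastic_iff.2 hW) hZ
  have hmono : Monovary μQ fun k => (-μS k)⁻¹ :=
    hμQmono.monovary fun i j hij =>
      inv_anti₀ (hμSneg j) (neg_le_neg (hμSmono hij))
  have hsum : ∑ i, p i ≤ ∑ i, μQ i * (-μS i)⁻¹ :=
    calc ∑ i, p i ≤ ∑ i, (∑ j, W i j * μQ j) * ∑ k, Z i k * (-μS k)⁻¹ :=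
          Finset.sum_le_sum fun i _ => hp i
      _ = ∑ j, ∑ k, (Wᵀ * Z) j k * (μQ j * (-μS k)⁻¹) := by
          simp_rw [mul_apply, Finset.sum_mul_sum, Finset.sum_mul]
          rw [Finset.sum_comm]
          refine Finset.sum_congr rfl fun j _ => ?_
          rw [Finset.sum_comm]
          refine Finset.sum_congr rfl fun k _ => Finset.sum_congr rfl fun i _ => ?_
          rw [transpose_apply]
          ring
      _ ≤ ∑ i, μQ i * (-μS i)⁻¹ := hmono.sum_mul_doublyStochastic_le hWZ
  have hfin : -∑ i, μQ i / (2 * μS i) = (∑ i, μQ i * (-μS i)⁻¹) / 2 := by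
    rw [Finset.sum_div, ← Finset.sum_neg_distrib]
    refine Finset.sum_congr rfl fun i _ => ?_
    have : μS i ≠ 0 := (neg_pos.1 (hμSneg i)).ne
    rw [inv_neg]
    field_simp
  rw [hfin]
  linarith
end
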